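/- Under the dispersion assumptions, for every φ ∈ C²_c([0,∞)) there exists a constant C_φ > 0 such that for all ω, ω₁, ω₂ > 0 with ω₃ := ω + ω₁ − ω₂ ≥ 0: | 𝒦(ω,ω₁,ω₂) · [φ(ω₂) + φ(ω₃) − φ(ω) − φ(ω₁)] | ≤ C_φ, where 𝒦(ω,ω₁,ω₂) := ℧(r(ω₃)) · min{r(ω), r(ω₁), r(ω₂), r(ω₃)} / (r(ω) r(ω₁) r(ω₂)) and r := Ω⁻¹. In other words, the weighted collision kernel tested against a C²_c test function is uniformly bounded on the admissible region {ω + ω₁ ≥ ω₂}. -/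

import Mathlib

open MeasureTheory Set Filter

/-- Dispersion assumptions on the profile `Ω` of the dispersion relation
`ω(k) = Ω(|k|)`, together with its inverse `r = Ω⁻¹` and the auxiliary
function `℧(ρ) = ρ / Ω'(ρ)` (named `U` here). -/
structure Dispersion where
  Ω : ℝ → ℝ
  Ω_zero : Ω 0 = 0
  Ω_smooth : ContDiffOn ℝ 1 Ω (Set.Ici 0)
  Ω_strictMono : StrictMonoOn Ω (Set.Ici 0)
  Ω_convex : ConvexOn ℝ (Set.Ici 0) Ω
  Ω_bij : Set.BijOn Ω (Set.Ici 0) (Set.Ici 0)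
  r : ℝ → ℝ
  r_nonneg : ∀ x, 0 ≤ x → 0 ≤ r x
  r_left : ∀ ρ, 0 ≤ ρ → r (Ω ρ) = ρ
  r_right : ∀ x, 0 ≤ x → Ω (r x) = x
  U : ℝ → ℝ
  U_def : ∀ ρ, 0 < ρ → U ρ = ρ / derivWithin Ω (Set.Ici 0) ρ
  U_mono : MonotoneOn U (Set.Ioi 0)
  CU : ℝ
  iota : ℝ
  CU_nonneg : 0 ≤ CU
  iota_nonneg : 0 ≤ iota
  iota_le_one : iota ≤ 1
  U_bound : ∀ ρ, 0 < ρ → U ρ ≤ CU * ρ ^ iota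
  α : ℝ
  α' : ℝ
  Cω : ℝ
  Cω' : ℝ
  α_gt_one : 1 < α
  α_le_two : α ≤ 2
  α'_gt_one : 1 < α'
  α'_le_α : α' ≤ α
  Cω_pos : 0 < Cω
  Cω'_pos : 0 < Cω'
  Ω_lower : ∀ ρ, 0 ≤ ρ → Cω * ρ ^ α ≤ Ω ρ
  Ω_upper : ∀ ρ, 0 ≤ ρ → ρ < 1 → Ω ρ ≤ Cω' * ρ ^ α'

/-- The collision kernel `𝒦(ω,ω₁,ω₂)` of the reduced 4-wave kinetic equation. -/
noncomputable def kernel (D : Dispersion) (ω ω₁ ω₂ : ℝ) : ℝ :=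
  D.U (D.r (ω + ω₁ - ω₂)) *
    min (min (D.r ω) (D.r ω₁)) (min (D.r ω₂) (D.r (ω + ω₁ - ω₂))) /
      (D.r ω * D.r ω₁ * D.r ω₂)

/-- `g : [0,∞) → L¹((0,∞))` is `C¹`: there is a time derivative `dg`, integrable in `ω`,
which is the derivative of `g` in the `L¹` sense, and which depends `L¹`-continuously
on time. -/
def C1inL1 (g : ℝ → ℝ → ℝ) : Prop :=
  ∃ dg : ℝ → ℝ → ℝ,
    (∀ t, 0 ≤ t → MeasureTheory.IntegrableOn (dg t) (Set.Ioi 0)) ∧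
    (∀ t, 0 ≤ t → Filter.Tendsto
      (fun h : ℝ => ∫ ω in Set.Ioi (0:ℝ), |g (t + h) ω - g t ω - h * dg t ω| / |h|)
      (nhdsWithin 0 {(0:ℝ)}ᶜ) (nhds 0)) ∧
    (∀ t, 0 ≤ t → Filter.Tendsto
      (fun s : ℝ => ∫ ω in Set.Ioi (0:ℝ), |dg s ω - dg t ω|) (nhds t) (nhds 0))

/-- A nonnegative `g ∈ C¹([0,∞); L¹((0,∞)))` is a global weak solution of the reduced
4-wave kinetic equation with collision constant `CQ` if the weak formulation holds for
every `C²` compactly supported test function. -/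
def IsWeakSolution (D : Dispersion) (CQ : ℝ) (g : ℝ → ℝ → ℝ) : Prop :=
  (∀ t, 0 ≤ t → ∀ ω, 0 < ω → 0 ≤ g t ω) ∧
  (∀ t, 0 ≤ t → MeasureTheory.IntegrableOn (g t) (Set.Ioi 0)) ∧
  C1inL1 g ∧
  ∀ φ : ℝ → ℝ, ContDiff ℝ 2 φ → HasCompactSupport φ → ∀ t, 0 ≤ t →
    (∫ ω in Set.Ioi (0:ℝ), g t ω * φ ω) - (∫ ω in Set.Ioi (0:ℝ), g 0 ω * φ ω) =
      CQ * ∫ s in (0:ℝ)..t, ∫ ω in Set.Ioi (0:ℝ), ∫ ω₁ in Set.Ioi (0:ℝ),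
        ∫ ω₂ in Set.Ioi (0:ℝ),
          g s ω * g s ω₁ * g s ω₂ * kernel D ω ω₁ ω₂ *
            (φ ω₂ + φ (ω + ω₁ - ω₂) - φ ω - φ ω₁) *
            (if ω₂ ≤ ω + ω₁ then (1:ℝ) else 0)

/-- A `C¹` function on `[0,∞)` that vanishes beyond `R` is bounded and Lipschitz. -/
lemma ContDiffOn.exists_bound_and_lipschitz {f : ℝ → ℝ} {R : ℝ} (hf : ContDiffOn ℝ 1 f (Ici 0))
    (hR : ∀ x, R < x → f x = 0) :
    ∃ M : ℝ, 0 ≤ M ∧ (∀ x, 0 ≤ x → |f x| ≤ M) ∧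
      ∀ x y, 0 ≤ x → 0 ≤ y → |f y - f x| ≤ M * |y - x| := by
  have hd : ContinuousOn (derivWithin f (Ici 0)) (Ici 0) :=
    hf.continuousOn_derivWithin (uniqueDiffOn_Ici 0) le_rfl
  have hdR : ∀ x, R < x → derivWithin f (Ici 0) x = 0 := by
    intro x hx
    have h : f =ᶠ[nhdsWithin x (Ici 0)] fun _ => 0 :=
      nhdsWithin_le_nhds ((eventually_gt_nhds hx).mono hR)
    rw [h.derivWithin_eq (hR x hx)]
    simp
  obtain ⟨A, hA⟩ := (isCompact_Icc (a := (0 : ℝ)) (b := R)).exists_bound_of_continuousOn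
    (hf.continuousOn.mono Icc_subset_Ici_self)
  obtain ⟨B, hB⟩ := (isCompact_Icc (a := (0 : ℝ)) (b := R)).exists_bound_of_continuousOn
    (hd.mono Icc_subset_Ici_self)
  have hA' : ∀ x, 0 ≤ x → |f x| ≤ max 0 (max A B) := by
    intro x hx
    rcases le_or_gt x R with h | h
    · exact (hA x ⟨hx, h⟩).trans ((le_max_left A B).trans (le_max_right _ _))
    · simp [hR x h]
  have hB' : ∀ x ∈ Ici (0 : ℝ), ‖derivWithin f (Ici 0) x‖ ≤ max 0 (max A B) := by
    intro x hx
    rcases le_or_gt x R with h | h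
    · exact (hB x ⟨hx, h⟩).trans ((le_max_right A B).trans (le_max_right _ _))
    · simp [hdR x h]
  exact ⟨max 0 (max A B), le_max_left _ _, hA', fun x y hx hy =>
    (convex_Ici 0).norm_image_sub_le_of_norm_derivWithin_le
      (hf.differentiableOn one_ne_zero) hB' hx hy⟩

/-- If `f` has an `M`-Lipschitz derivative on `[0,∞)`, its mixed second differences are
bounded by `M` times the product of the increments. -/
lemma abs_second_difference_le {f : ℝ → ℝ} {M : ℝ} (hf : DifferentiableOn ℝ f (Ici 0))
    (hM : ∀ x y, 0 ≤ x → 0 ≤ y →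
      |derivWithin f (Ici 0) y - derivWithin f (Ici 0) x| ≤ M * |y - x|)
    {a b c : ℝ} (ha : 0 ≤ a) (hab : a ≤ b) (hac : a ≤ c) :
    |f a + f (b + c - a) - f b - f c| ≤ M * (c - a) * (b - a) := by
  have hs : 0 ≤ c - a := sub_nonneg.2 hac
  have hderiv : ∀ t ∈ Ici (0 : ℝ), HasDerivWithinAt (fun t => f (t + (c - a)) - f t)
      (derivWithin f (Ici 0) (t + (c - a)) - derivWithin f (Ici 0) t) (Ici 0) t := by
    intro t ht
    have ht' : t + (c - a) ∈ Ici (0 : ℝ) := add_nonneg ht hs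
    have h := (hf _ ht').hasDerivWithinAt.comp t ((hasDerivWithinAt_id t (Ici 0)).add_const (c - a))
      (fun x hx => add_nonneg hx hs)
    exact (h.sub (hf t ht).hasDerivWithinAt).congr_deriv (by rw [mul_one])
  have h := (convex_Ici (0 : ℝ)).norm_image_sub_le_of_norm_hasDerivWithin_le (C := M * (c - a))
    hderiv (fun t ht => by
      have := hM t (t + (c - a)) ht (add_nonneg ht hs)
      rwa [add_sub_cancel_left, abs_of_nonneg hs] at this) ha (ha.trans hab)
  rw [Real.norm_eq_abs, Real.norm_eq_abs, abs_of_nonneg (sub_nonneg.2 hab)] at h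
  convert h using 2
  rw [show b + (c - a) = b + c - a by ring, add_sub_cancel]
  ring

/-- Mixed second differences of a compactly supported `C²` function on `[0,∞)`. -/
lemma exists_second_difference_bound {φ : ℝ → ℝ} (hφ : ContDiffOn ℝ 2 φ (Ici 0))
    (hφc : HasCompactSupport φ) :
    ∃ C : ℝ, 0 ≤ C ∧ ∀ a b c : ℝ, 0 ≤ a → a ≤ b → a ≤ c →
      |φ a + φ (b + c - a) - φ b - φ c| ≤ C * min 1 b * min 1 c := by
  obtain ⟨R, hR⟩ := hφc.isCompact.bddAbove
  have hzero : ∀ x, R < x → φ x = 0 := fun x hx =>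
    image_eq_zero_of_notMem_tsupport fun h => (hR h).not_gt hx
  have hzero' : ∀ x, R < x → derivWithin φ (Ici 0) x = 0 := by
    intro x hx
    have h : φ =ᶠ[nhdsWithin x (Ici 0)] fun _ => 0 :=
      nhdsWithin_le_nhds ((eventually_gt_nhds hx).mono hzero)
    rw [h.derivWithin_eq (hzero x hx)]
    simp
  obtain ⟨M, hM, hbdd, hlip⟩ := (hφ.of_le one_le_two).exists_bound_and_lipschitz hzero
  obtain ⟨N, hN, -, hlip'⟩ := (hφ.derivWithin (uniqueDiffOn_Ici 0)
    (by norm_num : (1 : WithTop ℕ∞) + 1 ≤ 2)).exists_bound_and_lipschitz hzero'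
  refine ⟨4 * M + N, by positivity, fun a b c ha hab hac => ?_⟩
  have hb : 0 ≤ b := ha.trans hab
  have hc : 0 ≤ c := ha.trans hac
  have hd : 0 ≤ b + c - a := by linarith
  have h_one : |φ a + φ (b + c - a) - φ b - φ c| ≤ 4 * M := by
    have h1 := abs_le.1 (hbdd a ha)
    have h2 := abs_le.1 (hbdd b hb)
    have h3 := abs_le.1 (hbdd c hc)
    have h4 := abs_le.1 (hbdd _ hd)
    exact abs_le.2 ⟨by linarith, by linarith⟩
  have h_left : |φ a + φ (b + c - a) - φ b - φ c| ≤ 2 * M * b := by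
    have h1 := hlip b a hb ha
    have h2 := hlip c (b + c - a) hc hd
    rw [abs_sub_comm a b, abs_of_nonneg (sub_nonneg.2 hab)] at h1
    rw [show b + c - a - c = b - a by ring, abs_of_nonneg (sub_nonneg.2 hab)] at h2
    have h1 := abs_le.1 h1
    have h2 := abs_le.1 h2
    have h3 : 0 ≤ M * a := mul_nonneg hM ha
    exact abs_le.2 ⟨by linarith, by linarith⟩
  have h_right : |φ a + φ (b + c - a) - φ b - φ c| ≤ 2 * M * c := by
    have h1 := hlip c a hc ha
    have h2 := hlip b (b + c - a) hb hd
    rw [abs_sub_comm a c, abs_of_nonneg (sub_nonneg.2 hac)] at h1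
    rw [show b + c - a - b = c - a by ring, abs_of_nonneg (sub_nonneg.2 hac)] at h2
    have h1 := abs_le.1 h1
    have h2 := abs_le.1 h2
    have h3 : 0 ≤ M * a := mul_nonneg hM ha
    exact abs_le.2 ⟨by linarith, by linarith⟩
  have h_both : |φ a + φ (b + c - a) - φ b - φ c| ≤ N * c * b :=
    (abs_second_difference_le (hφ.differentiableOn two_ne_zero) hlip' ha hab hac).trans
      (mul_le_mul (mul_le_mul_of_nonneg_left (by linarith) hN) (by linarith)
        (by linarith) (by positivity))
  have hMb : 0 ≤ M * b := mul_nonneg hM hb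
  have hMc : 0 ≤ M * c := mul_nonneg hM hc
  have hNb : 0 ≤ N * b := mul_nonneg hN hb
  have hNc : 0 ≤ N * c := mul_nonneg hN hc
  have hMbc : 0 ≤ M * b * c := mul_nonneg hMb hc
  rcases le_total 1 b with h1 | h1 <;> rcases le_total 1 c with h2 | h2 <;>
    simp only [h1, h2, min_eq_left, min_eq_right] <;> linarith

namespace Dispersion

variable (D : Dispersion)

lemma r_mono {x y : ℝ} (hx : 0 ≤ x) (hxy : x ≤ y) : D.r x ≤ D.r y := by
  rw [← D.Ω_strictMono.le_iff_le (D.r_nonneg x hx) (D.r_nonneg y (hx.trans hxy)),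
    D.r_right x hx, D.r_right y (hx.trans hxy)]
  exact hxy

lemma r_zero : D.r 0 = 0 := by
  simpa [D.Ω_zero] using D.r_left 0 le_rfl

lemma r_pos {x : ℝ} (hx : 0 < x) : 0 < D.r x := by
  refine (D.r_nonneg x hx.le).lt_of_ne fun h => hx.ne ?_
  rw [← D.r_right x hx.le, ← h, D.Ω_zero]

lemma Ω_mul_le {t ρ : ℝ} (ht : 0 ≤ t) (ht' : t ≤ 1) (hρ : 0 ≤ ρ) :
    D.Ω (t * ρ) ≤ t * D.Ω ρ := by
  have h := D.Ω_convex.2 (x := ρ) hρ (y := 0) (mem_Ici.2 le_rfl) ht (sub_nonneg.2 ht') (by ring)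
  simpa [D.Ω_zero] using h

lemma add_Ω_le {x y : ℝ} (hx : 0 < x) (hy : 0 < y) : D.Ω x + D.Ω y ≤ D.Ω (x + y) := by
  have hxy : 0 < x + y := add_pos hx hy
  have h1 := D.Ω_mul_le (t := x / (x + y)) (by positivity)
    ((div_le_one hxy).2 (by linarith)) hxy.le
  have h2 := D.Ω_mul_le (t := y / (x + y)) (by positivity)
    ((div_le_one hxy).2 (by linarith)) hxy.le
  rw [div_mul_cancel₀ _ hxy.ne'] at h1 h2
  have h3 : x / (x + y) * D.Ω (x + y) + y / (x + y) * D.Ω (x + y) = D.Ω (x + y) := by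
    field_simp
  linarith

lemma r_add_le {x y : ℝ} (hx : 0 < x) (hy : 0 < y) : D.r (x + y) ≤ D.r x + D.r y := by
  have hx' := D.r_pos hx
  have hy' := D.r_pos hy
  rw [← D.Ω_strictMono.le_iff_le (D.r_nonneg _ (add_pos hx hy).le) (add_pos hx' hy').le,
    D.r_right _ (add_pos hx hy).le]
  simpa [D.r_right, hx.le, hy.le] using D.add_Ω_le hx' hy'

lemma min_one_le {x : ℝ} (hx : 0 < x) : min 1 x ≤ (D.r 1)⁻¹ * D.r x := by
  have h1 := D.r_pos one_pos
  rw [inv_mul_eq_div]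
  rcases le_total x 1 with h | h
  · have := D.Ω_mul_le (t := D.r x / D.r 1) (div_nonneg (D.r_nonneg x hx.le) h1.le)
      ((div_le_one h1).2 (D.r_mono hx.le h)) h1.le
    rw [div_mul_cancel₀ _ h1.ne', D.r_right x hx.le, D.r_right 1 zero_le_one, mul_one] at this
    exact (min_le_right _ _).trans this
  · exact (min_le_left _ _).trans ((one_le_div h1).2 (D.r_mono zero_le_one h))

lemma U_nonneg {ρ : ℝ} (hρ : 0 < ρ) : 0 ≤ D.U ρ := by
  rw [D.U_def ρ hρ]
  exact div_nonneg hρ.le D.Ω_strictMono.monotoneOn.derivWithin_nonneg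

lemma U_le {ρ : ℝ} (hρ : 0 < ρ) : D.U ρ ≤ D.CU * (1 + ρ) := by
  refine (D.U_bound ρ hρ).trans (mul_le_mul_of_nonneg_left ?_ D.CU_nonneg)
  rcases le_total ρ 1 with h | h
  · linarith [Real.rpow_le_one hρ.le h D.iota_nonneg]
  · have := Real.rpow_le_rpow_of_exponent_le h D.iota_le_one
    rw [Real.rpow_one] at this
    linarith

/-- The mixed second difference of a test function compensates the singularity of the kernel
at the two middle frequencies, with one power of `r` at the largest one to spare. -/
lemma exists_weighted_second_difference_bound {φ : ℝ → ℝ} (hφ : ContDiffOn ℝ 2 φ (Ici 0))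
    (hφc : HasCompactSupport φ) :
    ∃ C : ℝ, 0 ≤ C ∧ ∀ a b c d : ℝ, 0 < a → a ≤ b → a ≤ c → a + d = b + c →
      (1 + D.r d) * |φ a + φ d - φ b - φ c| ≤ C * (D.r b * D.r c) := by
  obtain ⟨C, hC, h⟩ := exists_second_difference_bound hφ hφc
  have hK : 0 < (D.r 1)⁻¹ := inv_pos.2 (D.r_pos one_pos)
  set K := (D.r 1)⁻¹ with hKdef
  refine ⟨C * K ^ 2 + 2 * (C * K), by positivity, fun a b c d ha hab hac hd => ?_⟩
  have hb : 0 < b := ha.trans_le hab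
  have hc : 0 < c := ha.trans_le hac
  have hrb := D.r_pos hb
  have hrc := D.r_pos hc
  have hmb := D.min_one_le hb
  have hmc := D.min_one_le hc
  rw [← hKdef] at hmb hmc
  have hmb0 : 0 ≤ min 1 b := le_min zero_le_one hb.le
  have hmc0 : 0 ≤ min 1 c := le_min zero_le_one hc.le
  have hrd : D.r d ≤ D.r b + D.r c :=
    (D.r_mono (by linarith) (by linarith)).trans (D.r_add_le hb hc)
  have hB := h a b c ha.le hab hac
  obtain rfl : d = b + c - a := by linarith
  set B := |φ a + φ (b + c - a) - φ b - φ c|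
  have hbc : B ≤ C * K ^ 2 * (D.r b * D.r c) := calc
    B ≤ C * min 1 b * min 1 c := hB
    _ ≤ C * (K * D.r b) * (K * D.r c) := by gcongr
    _ = _ := by ring
  have hb' : B ≤ C * K * D.r b := calc
    B ≤ C * min 1 b * min 1 c := hB
    _ ≤ C * (K * D.r b) * 1 := by gcongr; exact min_le_left _ _
    _ = _ := by ring
  have hc' : B ≤ C * K * D.r c := calc
    B ≤ C * min 1 b * min 1 c := hB
    _ ≤ C * 1 * (K * D.r c) := by gcongr; exact min_le_left _ _
    _ = _ := by ring
  calc (1 + D.r (b + c - a)) * B ≤ (1 + (D.r b + D.r c)) * B := by gcongr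
    _ = B + D.r b * B + D.r c * B := by ring
    _ ≤ C * K ^ 2 * (D.r b * D.r c) + D.r b * (C * K * D.r c) + D.r c * (C * K * D.r b) := by
        gcongr
    _ = _ := by ring

end Dispersion

/-- Under the dispersion assumptions, for every compactly supported
`C²` test function `φ` on `[0,∞)` there is a constant `Cφ > 0` bounding the
collision kernel tested against `φ` uniformly on the admissible region
`{ω + ω₁ ≥ ω₂}`. -/
theorem tested_kernel_uniformly_bounded (D : Dispersion) (φ : ℝ → ℝ)
    (hφ : ContDiffOn ℝ 2 φ (Set.Ici 0)) (hφc : HasCompactSupport φ) :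
    ∃ Cφ : ℝ, 0 < Cφ ∧
      ∀ ω ω₁ ω₂ : ℝ, 0 < ω → 0 < ω₁ → 0 < ω₂ → 0 ≤ ω + ω₁ - ω₂ →
        |kernel D ω ω₁ ω₂ * (φ ω₂ + φ (ω + ω₁ - ω₂) - φ ω - φ ω₁)| ≤ Cφ := by
  obtain ⟨C, hC, hbound⟩ := D.exists_weighted_second_difference_bound hφ hφc
  have hCU := D.CU_nonneg
  refine ⟨D.CU * C + 1, by positivity, fun ω ω₁ ω₂ hω hω₁ hω₂ hω₃ => ?_⟩
  obtain ⟨ω₃, hsum⟩ : ∃ ω₃, ω + ω₁ - ω₂ = ω₃ := ⟨_, rfl⟩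
  have hadd : ω₂ + ω₃ = ω + ω₁ := by linarith
  have hr := D.r_pos hω
  have hr₁ := D.r_pos hω₁
  have hr₂ := D.r_pos hω₂
  unfold kernel
  rw [hsum] at hω₃ ⊢
  rcases hω₃.eq_or_lt with rfl | hω₃
  · have : min (min (D.r ω) (D.r ω₁)) (min (D.r ω₂) 0) = 0 := by
      rw [min_eq_right hr₂.le, min_eq_right (le_min hr.le hr₁.le)]
    rw [D.r_zero, this]
    simpa using add_nonneg (mul_nonneg hCU hC) zero_le_one
  have hr₃ := D.r_pos hω₃
  set m := min (min (D.r ω) (D.r ω₁)) (min (D.r ω₂) (D.r ω₃))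
  have hm : 0 ≤ m := le_min (le_min hr.le hr₁.le) (le_min hr₂.le hr₃.le)
  have hm0 : m ≤ D.r ω := (min_le_left _ _).trans (min_le_left _ _)
  have hm1 : m ≤ D.r ω₁ := (min_le_left _ _).trans (min_le_right _ _)
  have hm2 : m ≤ D.r ω₂ := (min_le_right _ _).trans (min_le_left _ _)
  have hm3 : m ≤ D.r ω₃ := (min_le_right _ _).trans (min_le_right _ _)
  set B := φ ω₂ + φ ω₃ - φ ω - φ ω₁ with hB
  have key : (1 + D.r ω₃) * |B| * m ≤ C * (D.r ω * D.r ω₁ * D.r ω₂) := by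
    have hcases : (ω ≤ ω₂ ∧ ω ≤ ω₃) ∨ (ω₁ ≤ ω₂ ∧ ω₁ ≤ ω₃) ∨ (ω₂ ≤ ω ∧ ω₂ ≤ ω₁) ∨
        (ω₃ ≤ ω ∧ ω₃ ≤ ω₁) := by
      rcases le_total ω ω₂ with h1 | h1 <;> rcases le_total ω ω₃ with h2 | h2
      · exact Or.inl ⟨h1, h2⟩
      · exact Or.inr (Or.inr (Or.inr ⟨h2, by linarith⟩))
      · exact Or.inr (Or.inr (Or.inl ⟨h1, by linarith⟩))
      · exact Or.inr (Or.inl ⟨by linarith, by linarith⟩)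
    rcases hcases with ⟨h1, h2⟩ | ⟨h1, h2⟩ | ⟨h1, h2⟩ | ⟨h1, h2⟩
    · have h := hbound ω ω₂ ω₃ ω₁ hω h1 h2 hadd.symm
      rw [show φ ω + φ ω₁ - φ ω₂ - φ ω₃ = -B by rw [hB]; ring, abs_neg] at h
      have h31 : D.r ω₃ ≤ D.r ω₁ := D.r_mono hω₃.le (by linarith)
      calc (1 + D.r ω₃) * |B| * m ≤ (1 + D.r ω₁) * |B| * D.r ω := by gcongr
        _ ≤ C * (D.r ω₂ * D.r ω₃) * D.r ω := by gcongr
        _ ≤ C * (D.r ω₂ * D.r ω₁) * D.r ω := by gcongr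
        _ = _ := by ring
    · have h := hbound ω₁ ω₂ ω₃ ω hω₁ h1 h2 (by linarith)
      rw [show φ ω₁ + φ ω - φ ω₂ - φ ω₃ = -B by rw [hB]; ring, abs_neg] at h
      have h30 : D.r ω₃ ≤ D.r ω := D.r_mono hω₃.le (by linarith)
      calc (1 + D.r ω₃) * |B| * m ≤ (1 + D.r ω) * |B| * D.r ω₁ := by gcongr
        _ ≤ C * (D.r ω₂ * D.r ω₃) * D.r ω₁ := by gcongr
        _ ≤ C * (D.r ω₂ * D.r ω) * D.r ω₁ := by gcongr
        _ = _ := by ring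
    · have h := hbound ω₂ ω ω₁ ω₃ hω₂ h1 h2 hadd
      calc (1 + D.r ω₃) * |B| * m ≤ (1 + D.r ω₃) * |B| * D.r ω₂ := by gcongr
        _ ≤ C * (D.r ω * D.r ω₁) * D.r ω₂ := by gcongr
        _ = _ := by ring
    · have h := hbound ω₃ ω ω₁ ω₂ hω₃ h1 h2 (by linarith)
      rw [show φ ω₃ + φ ω₂ - φ ω - φ ω₁ = B by rw [hB]; ring] at h
      have h32 : D.r ω₃ ≤ D.r ω₂ := D.r_mono hω₃.le (by linarith)
      calc (1 + D.r ω₃) * |B| * m ≤ (1 + D.r ω₂) * |B| * D.r ω₂ := by gcongr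
        _ ≤ C * (D.r ω * D.r ω₁) * D.r ω₂ := by gcongr
        _ = _ := by ring
  have hU := D.U_nonneg hr₃
  have hP : 0 < D.r ω * D.r ω₁ * D.r ω₂ := by positivity
  rw [abs_mul, abs_of_nonneg (by positivity), div_mul_eq_mul_div, div_le_iff₀ hP]
  calc D.U (D.r ω₃) * m * |B| ≤ D.CU * (1 + D.r ω₃) * m * |B| := by
        gcongr
        exact D.U_le hr₃
    _ = D.CU * ((1 + D.r ω₃) * |B| * m) := by ring
    _ ≤ D.CU * (C * (D.r ω * D.r ω₁ * D.r ω₂)) := by gcongr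
    _ ≤ (D.CU * C + 1) * (D.r ω * D.r ω₁ * D.r ω₂) := by linarith
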